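/- Let P be a POMDP whose goal state G is absorbing (δ(G, a)(G) = 1 for all a ∈ A), let M be a finite memory set of size μ with initial memory state m₀ ∈ M, and let k ∈ ℕ. (i) If the constraint system Φ_{k,μ} is satisfiable, say by assignment v, then the small-memory strategy σ = (σ_u, σ_n, M, m₀) of size μ, where σ_n(m) is the uniform distribution on {a : v(A_{m,a}) = true} and σ_u(m,z,a) is the uniform distribution on {m' : v(M_{m,z,a,m'}) = true}, is almost-sure winning for Reach({G}). (ii) If Φ_{k,μ} is unsatisfiable and k ≥ |S|·μ, then P has no small-memory almost-sure winning strategy of size μ. -/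

import Mathlib

open scoped ENNReal
open Filter
open scoped Classical

/-- A POMDP with state space `S`, action alphabet `A`, observations `Z`,
probabilistic transition function, observation function, initial state and goal state. -/
structure POMDP (S A Z : Type) where
  trans : S → A → PMF S
  obs : S → Z
  init : S
  goal : S

namespace POMDP

variable {S A Z : Type}

/-- A memoryless (observation-stationary) strategy: states with equal observations
get equal distributions over actions. -/
def Memoryless (P : POMDP S A Z) (σ : S → PMF A) : Prop :=
  ∀ s s' : S, P.obs s = P.obs s' → σ s = σ s'

/-- Finite-horizon reach probabilities `p_n` for the goal state under strategy `σ`. -/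
noncomputable def preach (P : POMDP S A Z) (σ : S → PMF A) : ℕ → S → ℝ≥0∞
  | 0, s => if s = P.goal then 1 else 0
  | n + 1, s =>
      if s = P.goal then 1
      else ∑' a : A, σ s a * ∑' s' : S, P.trans s a s' * P.preach σ n s'

/-- `σ` is almost-sure winning for `Reach({G})` iff `p_n(I) → 1`. -/
def AlmostSureWinning (P : POMDP S A Z) (σ : S → PMF A) : Prop :=
  Tendsto (fun n => P.preach σ n P.init) atTop (nhds 1)

/-- A finite path `(s₁, a₁, …, s_{k+1})` (with `k+1` states, `k` transitions)
is compatible with `σ` if each action has positive strategy probability and each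
transition has positive transition probability. -/
def IsCompatPath (P : POMDP S A Z) (σ : S → PMF A) (k : ℕ)
    (st : Fin (k + 1) → S) (ac : Fin k → A) : Prop :=
  ∀ i : Fin k,
    0 < σ (st i.castSucc) (ac i) ∧ 0 < P.trans (st i.castSucc) (ac i) (st i.succ)

/-- `R_σ`: the least set of states containing the initial state and closed under
σ-positive one-step transitions. -/
inductive ReachSet (P : POMDP S A Z) (σ : S → PMF A) : S → Prop
  | init : ReachSet P σ P.init
  | step {s s' : S} (a : A) :
      ReachSet P σ s → 0 < σ s a → 0 < P.trans s a s' → ReachSet P σ s'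

end POMDP

namespace POMDP

variable {S A Z : Type}

/-- Finite-horizon reach probabilities `q_n : S × M → [0,1]` for a strategy with
memory given by action selection function `σn` and memory update function `σu`. -/
noncomputable def qreach (P : POMDP S A Z) {M : Type}
    (σn : M → PMF A) (σu : M → Z → A → PMF M) : ℕ → S → M → ℝ≥0∞
  | 0, s, _ => if s = P.goal then 1 else 0
  | n + 1, s, m =>
      if s = P.goal then 1
      else ∑' a : A, σn m a * ∑' s' : S, P.trans s a s' *
        ∑' m' : M, σu m (P.obs s) a m' * P.qreach σn σu n s' m'

/-- A finite sequence `(s₁, m₁, a₁, …, s_{k+1}, m_{k+1})` (with `k+1` state–memory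
pairs) is a σ-compatible path for the strategy with memory `(σn, σu)`. -/
def IsCompatPathMem (P : POMDP S A Z) {M : Type}
    (σn : M → PMF A) (σu : M → Z → A → PMF M) (k : ℕ)
    (st : Fin (k + 1) → S) (mem : Fin (k + 1) → M) (ac : Fin k → A) : Prop :=
  ∀ i : Fin k,
    0 < P.trans (st i.castSucc) (ac i) (st i.succ) ∧
    0 < σn (mem i.castSucc) (ac i) ∧
    0 < σu (mem i.castSucc) (P.obs (st i.castSucc)) (ac i) (mem i.succ)

end POMDP

/-- A satisfying assignment for the constraint system `Φ_{k,μ}`: truth values for the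
variables `A_{m,a}`, `M_{m,z,a,m'}`, `C_{i,m}` and `P_{i,m,j}` (0 ≤ j ≤ k) satisfying
constraints (1)–(7). -/
def SatPhiMem {S A Z M : Type} (P : POMDP S A Z) (m₀ : M) (k : ℕ)
    (vA : M → A → Bool) (vM : M → Z → A → M → Bool)
    (vC : S → M → Bool) (vP : S → M → ℕ → Bool) : Prop :=
  (∀ m : M, ∃ a : A, vA m a = true) ∧
  (∀ (m : M) (z : Z) (a : A), ∃ m' : M, vM m z a m' = true) ∧
  vC P.init m₀ = true ∧
  (∀ (i ℓ : S) (m m' : M) (a : A), 0 < P.trans i a ℓ →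
    vC i m = true → vA m a = true → vM m (P.obs i) a m' = true →
    vC ℓ m' = true) ∧
  (∀ (i : S) (m : M), (vP i m 0 = true ↔ i = P.goal)) ∧
  (∀ (m : M) (j : ℕ), j ≤ k → vP P.goal m j = true) ∧
  (∀ (i : S) (m : M), vC i m = true → vP i m k = true) ∧
  (∀ (i : S) (m : M) (j : ℕ), 1 ≤ j → j ≤ k →
    (vP i m j = true ↔ ∃ a : A, vA m a = true ∧
      ∃ m' : M, vM m (P.obs i) a m' = true ∧
        ∃ i' : S, 0 < P.trans i a i' ∧ vP i' m' (j - 1) = true))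

namespace PMF

lemma tsum_pure_mul {α : Type*} (a : α) (g : α → ℝ≥0∞) :
    ∑' x, PMF.pure a x * g x = g a := by
  rw [tsum_eq_single a (fun x hx => by simp [hx])]
  simp

lemma tsum_bind_mul {α β : Type*} (p : PMF α) (f : α → PMF β) (g : β → ℝ≥0∞) :
    ∑' b, p.bind f b * g b = ∑' a, p a * ∑' b, f a b * g b := by
  simp only [PMF.bind_apply, ← ENNReal.tsum_mul_right, ← ENNReal.tsum_mul_left]
  rw [ENNReal.tsum_comm]
  simp only [mul_assoc]

/-- If the mean of `g` is the finite value `v` and `g ≥ v` on the support,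
then `g = v` on the support. -/
lemma eq_of_tsum_mul_eq_of_ge {α : Type*} (p : PMF α) (g : α → ℝ≥0∞) {v : ℝ≥0∞} (hv : v ≠ ∞)
    (hmean : ∑' a, p a * g a = v) (hge : ∀ a ∈ p.support, v ≤ g a) {a : α}
    (ha : a ∈ p.support) : g a = v := by
  by_contra hne
  have hlt : v < g a := lt_of_le_of_ne (hge a ha) (Ne.symm hne)
  have hconst : ∑' a, p a * v = v := by rw [ENNReal.tsum_mul_right, p.tsum_coe, one_mul]
  refine (ENNReal.tsum_lt_tsum (f := fun a => p a * v) (g := fun a => p a * g a) (i := a)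
    (hconst.symm ▸ hv) (fun b => ?_)
    (ENNReal.mul_lt_mul_right ((p.mem_support_iff a).1 ha) (p.apply_ne_top a) hlt)).ne
    (hconst.trans hmean.symm)
  by_cases hb : b ∈ p.support
  · exact mul_le_mul_right (hge b hb) _
  · simp [(p.apply_eq_zero_iff b).2 hb]

/-- If the mean of `g ≤ v` is the finite value `v`, then `g = v` on the support. -/
lemma eq_of_tsum_mul_eq_of_le {α : Type*} (p : PMF α) (g : α → ℝ≥0∞) {v : ℝ≥0∞} (hv : v ≠ ∞)
    (hmean : ∑' a, p a * g a = v) (hle : ∀ a, g a ≤ v) {a : α}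
    (ha : a ∈ p.support) : g a = v := by
  by_contra hne
  have hlt : g a < v := lt_of_le_of_ne (hle a) hne
  have hconst : ∑' a, p a * v = v := by rw [ENNReal.tsum_mul_right, p.tsum_coe, one_mul]
  refine (ENNReal.tsum_lt_tsum (f := fun a => p a * g a) (g := fun a => p a * v) (i := a)
    (hmean.symm ▸ hv) (fun b => mul_le_mul_right (hle b) _)
    (ENNReal.mul_lt_mul_right ((p.mem_support_iff a).1 ha) (p.apply_ne_top a) hlt)).ne
    (hmean.trans hconst.symm)

/-- The uniform distribution on the elements of a finite type where `v` is true. -/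
lemma exists_uniform_of_bool {α : Type*} [Finite α] (v : α → Bool) (h : ∃ a, v a = true) :
    ∃ p : PMF α, ∀ a, p a =
      if v a then ((Nat.card {b : α // v b = true} : ℝ≥0∞))⁻¹ else 0 := by
  have := Fintype.ofFinite α
  have hne : (Finset.univ.filter fun a => v a = true).Nonempty :=
    h.imp fun a ha => by simpa using ha
  refine ⟨PMF.uniformOfFinset _ hne, fun a => ?_⟩
  simp [PMF.uniformOfFinset_apply, Nat.card_eq_fintype_card, Fintype.card_subtype]

end PMF

/-- The probability that the Markov chain `κ` hits `G` within `n` steps. -/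
noncomputable def hitProb {T : Type*} (κ : T → PMF T) (G : Set T) : ℕ → T → ℝ≥0∞
  | 0, t => if t ∈ G then 1 else 0
  | n + 1, t => if t ∈ G then 1 else ∑' t', κ t t' * hitProb κ G n t'

section HitProb

variable {T : Type*} (κ : T → PMF T) (G : Set T)

lemma hitProb_of_mem {t : T} (ht : t ∈ G) (n : ℕ) : hitProb κ G n t = 1 := by
  cases n <;> simp [hitProb, ht]

lemma hitProb_succ_of_notMem {t : T} (ht : t ∉ G) (n : ℕ) :
    hitProb κ G (n + 1) t = ∑' t', κ t t' * hitProb κ G n t' := by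
  simp [hitProb, ht]

lemma hitProb_le_one (n : ℕ) (t : T) : hitProb κ G n t ≤ 1 := by
  induction n generalizing t with
  | zero => unfold hitProb; split_ifs <;> simp
  | succ n ih =>
    by_cases ht : t ∈ G
    · exact (hitProb_of_mem κ G ht _).le
    · rw [hitProb_succ_of_notMem κ G ht, ← (κ t).tsum_coe]
      exact ENNReal.tsum_le_tsum fun t' => mul_le_of_le_one_right' (ih t')

lemma hitProb_mono (t : T) : Monotone fun n => hitProb κ G n t := by
  refine monotone_nat_of_le_succ fun n => ?_
  induction n generalizing t with
  | zero =>
    by_cases ht : t ∈ G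
    · simp [hitProb_of_mem κ G ht]
    · simp [hitProb, ht]
  | succ n ih =>
    by_cases ht : t ∈ G
    · simp [hitProb_of_mem κ G ht]
    · rw [hitProb_succ_of_notMem κ G ht, hitProb_succ_of_notMem κ G ht]
      exact ENNReal.tsum_le_tsum fun t' => mul_le_mul_right (ih t') _

lemma tendsto_hitProb (t : T) :
    Tendsto (fun n => hitProb κ G n t) atTop (nhds (⨆ n, hitProb κ G n t)) :=
  tendsto_atTop_iSup (hitProb_mono κ G t)

lemma iSup_hitProb_le_one (t : T) : ⨆ n, hitProb κ G n t ≤ 1 :=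
  iSup_le fun n => hitProb_le_one κ G n t

lemma iSup_hitProb_of_mem {t : T} (ht : t ∈ G) : ⨆ n, hitProb κ G n t = 1 := by
  simp [hitProb_of_mem κ G ht]

lemma tsum_mul_iSup_hitProb [Finite T] {t : T} (ht : t ∉ G) :
    ∑' t', κ t t' * ⨆ n, hitProb κ G n t' = ⨆ n, hitProb κ G n t := by
  have := Fintype.ofFinite T
  refine tendsto_nhds_unique ?_ ((tendsto_add_atTop_iff_nat 1).2 (tendsto_hitProb κ G t))
  simp only [hitProb_succ_of_notMem κ G ht, tsum_fintype]
  exact tendsto_finsetSum _ fun t' _ =>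
    ENNReal.Tendsto.const_mul (tendsto_hitProb κ G t') (Or.inr ((κ t).apply_ne_top t'))

lemma hitProb_succ_pos_iff {t : T} (ht : t ∉ G) (n : ℕ) :
    0 < hitProb κ G (n + 1) t ↔ ∃ t' ∈ (κ t).support, 0 < hitProb κ G n t' := by
  simp [hitProb_succ_of_notMem κ G ht, pos_iff_ne_zero, ENNReal.tsum_eq_zero, PMF.mem_support_iff]

/-- A state of positive hitting probability has positive probability of hitting within as many
steps as there are states. -/
lemma hitProb_pos_of_card_le [Finite T] {k n : ℕ} (hk : Nat.card T ≤ k) {t : T}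
    (hpos : 0 < hitProb κ G n t) : 0 < hitProb κ G k t := by
  let U : ℕ → Set T := fun j => {t | 0 < hitProb κ G j t}
  have hU : Monotone U := fun i j hij t (ht : 0 < _) => ht.trans_le (hitProb_mono κ G t hij)
  have hstep : ∀ j, U j = U (j + 1) → U (j + 1) = U (j + 2) := fun j hj => by
    ext t
    by_cases ht : t ∈ G
    · simp [U, hitProb_of_mem κ G ht]
    · simp only [U, Set.mem_ofPred_eq, hitProb_succ_pos_iff κ G ht]
      exact exists_congr fun t' => and_congr_right fun _ => Set.ext_iff.1 hj t'
  have hcard : ∀ m, Nat.card T ≤ m → (U m).ncard = (U (Nat.card T)).ncard := fun m hm =>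
    Nat.stabilises_of_monotone (f := fun j => (U j).ncard)
      (fun i j hij => Set.ncard_le_ncard (hU hij) (Set.toFinite _))
      (fun j => Set.ncard_le_card (U j))
      (fun j hj => congrArg Set.ncard <| hstep j <|
        Set.eq_of_subset_of_ncard_le (hU j.le_succ) hj.ge (Set.toFinite _)) hm
  have heq : U k = U (max k n) :=
    Set.eq_of_subset_of_ncard_le (hU (le_max_left k n))
      ((hcard _ (hk.trans (le_max_left k n))).trans (hcard k hk).symm).le (Set.toFinite _)
  have hmem : t ∈ U (max k n) := hU (le_max_right k n) hpos
  rwa [← heq] at hmem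

/-- Along transitions, almost-sure hitting is preserved outside `G`. -/
lemma iSup_hitProb_eq_one_of_mem_support [Finite T] {t t' : T} (ht : t ∉ G)
    (h : ⨆ n, hitProb κ G n t = 1) (ht' : t' ∈ (κ t).support) : ⨆ n, hitProb κ G n t' = 1 :=
  (κ t).eq_of_tsum_mul_eq_of_le _ ENNReal.one_ne_top ((tsum_mul_iSup_hitProb κ G ht).trans h)
    (iSup_hitProb_le_one κ G) ht'

/-- If every state of a closed set `C` has positive probability of hitting `G`,
then `G` is hit almost surely from `C`. -/
lemma iSup_hitProb_eq_one_of_closed [Finite T] {C : Set T}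
    (hclosed : ∀ t ∈ C, ∀ t' ∈ (κ t).support, t' ∈ C)
    (hpos : ∀ t ∈ C, ∃ n, 0 < hitProb κ G n t) {t : T} (ht : t ∈ C) :
    ⨆ n, hitProb κ G n t = 1 := by
  obtain ⟨u, huC, hmin⟩ := C.toFinite.exists_minimalFor (fun t => ⨆ n, hitProb κ G n t) C ⟨t, ht⟩
  have hmin' : ∀ w ∈ C, ⨆ n, hitProb κ G n u ≤ ⨆ n, hitProb κ G n w := fun w hw =>
    (le_total _ _).elim id (hmin hw)
  have key : ∀ n, ∀ w ∈ C, 0 < hitProb κ G n w →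
      ⨆ n, hitProb κ G n w = ⨆ n, hitProb κ G n u → ⨆ n, hitProb κ G n u = 1 := by
    intro n
    induction n with
    | zero =>
      intro w _ hw heq
      have hwG : w ∈ G := by
        by_contra hwG
        simp [hitProb, hwG] at hw
      rw [← heq, iSup_hitProb_of_mem κ G hwG]
    | succ n ih =>
      intro w hwC hw heq
      by_cases hwG : w ∈ G
      · rw [← heq, iSup_hitProb_of_mem κ G hwG]
      obtain ⟨w', hw', hpos'⟩ := (hitProb_succ_pos_iff κ G hwG n).1 hw
      refine ih w' (hclosed w hwC w' hw') hpos' ?_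
      exact (κ w).eq_of_tsum_mul_eq_of_ge (fun t => ⨆ n, hitProb κ G n t)
        ((iSup_hitProb_le_one κ G u).trans_lt ENNReal.one_lt_top).ne
        ((tsum_mul_iSup_hitProb κ G hwG).trans heq)
        (fun x hx => hmin' x (hclosed w hwC x hx)) hw'
  obtain ⟨n, hn⟩ := hpos u huC
  exact le_antisymm (iSup_hitProb_le_one κ G t) ((key n u huC hn rfl).symm.le.trans (hmin' t ht))

lemma tendsto_hitProb_one_iff {t : T} :
    Tendsto (fun n => hitProb κ G n t) atTop (nhds 1) ↔ ⨆ n, hitProb κ G n t = 1 :=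
  ⟨fun h => tendsto_nhds_unique (tendsto_hitProb κ G t) h, fun h => h ▸ tendsto_hitProb κ G t⟩

end HitProb

namespace POMDP

variable {S A Z M : Type} (P : POMDP S A Z) (σn : M → PMF A) (σu : M → Z → A → PMF M)

/-- The Markov chain on state–memory pairs induced by a strategy with memory. -/
noncomputable def memStep (t : S × M) : PMF (S × M) :=
  (σn t.2).bind fun a => (P.trans t.1 a).bind fun s' =>
    (σu t.2 (P.obs t.1) a).bind fun m' => PMF.pure (s', m')

lemma mem_support_memStep_iff (i i' : S) (m m' : M) :
    (i', m') ∈ (P.memStep σn σu (i, m)).support ↔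
      ∃ a, 0 < σn m a ∧ 0 < P.trans i a i' ∧ 0 < σu m (P.obs i) a m' := by
  simp [memStep, PMF.mem_support_iff, pos_iff_ne_zero, and_left_comm]

lemma qreach_eq_hitProb (n : ℕ) (s : S) (m : M) :
    P.qreach σn σu n s m = hitProb (P.memStep σn σu) {t | t.1 = P.goal} n (s, m) := by
  induction n generalizing s m with
  | zero => simp [qreach, hitProb]
  | succ n ih =>
    simp only [qreach, hitProb, memStep, PMF.tsum_bind_mul, PMF.tsum_pure_mul, ih,
      Set.mem_ofPred_eq]

end POMDP

/-- (i) From any satisfying assignment of `Φ_{k,μ}`, the small-memory strategy whose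
action selection (resp. memory update) function is the uniform distribution on the true
`A_{m,a}` (resp. `M_{m,z,a,m'}`) variables is almost-sure winning.
(ii) If `Φ_{k,μ}` is unsatisfiable and `k ≥ |S|·μ`, then there is no small-memory
almost-sure winning strategy of size μ. -/
theorem satPhiMem_sound_and_complete
    {S A Z : Type} [Fintype S] [Nonempty S] [Fintype A] [Nonempty A] [Fintype Z]
    (P : POMDP S A Z) (habs : ∀ a : A, P.trans P.goal a P.goal = 1)
    (μ : ℕ) (M : Type) [Finite M] (hM : Nat.card M = μ) (m₀ : M) (k : ℕ) :
    (∀ (vA : M → A → Bool) (vM : M → Z → A → M → Bool)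
        (vC : S → M → Bool) (vP : S → M → ℕ → Bool),
      SatPhiMem P m₀ k vA vM vC vP →
        ∃ (σn : M → PMF A) (σu : M → Z → A → PMF M),
          (∀ (m : M) (a : A), σn m a =
            if vA m a then ((Nat.card {b : A // vA m b = true} : ℝ≥0∞))⁻¹ else 0) ∧
          (∀ (m : M) (z : Z) (a : A) (m' : M), σu m z a m' =
            if vM m z a m' then
              ((Nat.card {m'' : M // vM m z a m'' = true} : ℝ≥0∞))⁻¹ else 0) ∧
          Tendsto (fun n => P.qreach σn σu n P.init m₀) atTop (nhds 1)) ∧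
    (Fintype.card S * μ ≤ k →
      (¬ ∃ (vA : M → A → Bool) (vM : M → Z → A → M → Bool)
          (vC : S → M → Bool) (vP : S → M → ℕ → Bool),
        SatPhiMem P m₀ k vA vM vC vP) →
      ¬ ∃ (M' : Type) (_ : Finite M') (m₀' : M')
          (σn : M' → PMF A) (σu : M' → Z → A → PMF M'),
        Nat.card M' = μ ∧
        Tendsto (fun n => P.qreach σn σu n P.init m₀') atTop (nhds 1)) := by
  refine ⟨fun vA vM vC vP hΦ => ?_, fun hk hunsat => ?_⟩
  · obtain ⟨h1, h2, h3, h4, h5, -, h6, h7⟩ := hΦ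
    choose σn hσn using fun m => PMF.exists_uniform_of_bool (vA m) (h1 m)
    choose σu hσu using fun m z a => PMF.exists_uniform_of_bool (vM m z a) (h2 m z a)
    refine ⟨σn, σu, hσn, hσu, ?_⟩
    have hA : ∀ m a, 0 < σn m a ↔ vA m a = true := fun m a => by
      rw [hσn]; split_ifs with h <;> simp [h]
    have hU : ∀ m z a m', 0 < σu m z a m' ↔ vM m z a m' = true := fun m z a m' => by
      rw [hσu]; split_ifs with h <;> simp [h]
    simp only [P.qreach_eq_hitProb]
    rw [tendsto_hitProb_one_iff]
    refine iSup_hitProb_eq_one_of_closed _ _ (C := {t : S × M | vC t.1 t.2 = true}) ?_ ?_ h3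
    · rintro ⟨i, m⟩ hC ⟨i', m'⟩ hsupp
      obtain ⟨a, ha, ht, hm⟩ := (P.mem_support_memStep_iff σn σu i i' m m').1 hsupp
      exact h4 i i' m m' a ht hC ((hA _ _).1 ha) ((hU _ _ _ _).1 hm)
    · have hP : ∀ j ≤ k, ∀ i m, vP i m j = true →
          0 < hitProb (P.memStep σn σu) {t | t.1 = P.goal} j (i, m) := by
        intro j
        induction j with
        | zero =>
          intro _ i m hv
          simp [hitProb, (h5 i m).1 hv]
        | succ j ih =>
          intro hj i m hv
          by_cases hi : i = P.goal
          · simp [hitProb, hi]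
          obtain ⟨a, ha, m', hm', i', ht, hv'⟩ := (h7 i m (j + 1) j.succ_pos hj).1 hv
          refine (hitProb_succ_pos_iff _ _ (t := (i, m)) hi j).2 ⟨(i', m'), ?_, ih (j.le_succ.trans hj) i' m' hv'⟩
          exact (P.mem_support_memStep_iff ..).2 ⟨a, (hA _ _).2 ha, ht, (hU _ _ _ _).2 hm'⟩
      exact fun t ht => ⟨k, hP k le_rfl t.1 t.2 (h6 t.1 t.2 ht)⟩
  · rintro ⟨M', _, m₀', σn, σu, hM', hwin⟩
    obtain ⟨e₀⟩ : Nonempty (M ≃ M') := Finite.card_eq.1 (hM.trans hM'.symm)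
    obtain ⟨e, he⟩ : ∃ e : M ≃ M', e m₀ = m₀' :=
      ⟨e₀.trans (Equiv.swap (e₀ m₀) m₀'), by simp⟩
    simp only [P.qreach_eq_hitProb] at hwin
    rw [tendsto_hitProb_one_iff] at hwin
    set κ := P.memStep σn σu
    set G : Set (S × M') := {t | t.1 = P.goal} with hG
    have hgoal : ∀ m j, 0 < hitProb κ G j (P.goal, m) := fun m j => by
      rw [hitProb_of_mem κ G rfl]; exact one_pos
    have hexA : ∀ m, ∃ a, 0 < σn m a := fun m =>
      (σn m).support_nonempty.imp fun a ha => pos_iff_ne_zero.2 ha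
    have hexM : ∀ m z a, ∃ m', 0 < σu m z a m' := fun m z a =>
      (σu m z a).support_nonempty.imp fun m' hm' => pos_iff_ne_zero.2 hm'
    refine hunsat ⟨fun m a => decide (0 < σn (e m) a),
      fun m z a m' => decide (0 < σu (e m) z a (e m')),
      fun i m => decide (⨆ n, hitProb κ G n (i, e m) = 1),
      fun i m j => decide (0 < hitProb κ G j (i, e m)), ?_⟩
    simp only [SatPhiMem, decide_eq_true_eq]
    refine ⟨fun m => hexA _, fun m z a => ?_, he ▸ hwin, ?_, ?_, fun m j _ => hgoal _ j, ?_, ?_⟩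
    · obtain ⟨m', hm'⟩ := hexM (e m) z a
      exact ⟨e.symm m', by simpa using hm'⟩
    · intro i ℓ m m' a ht hC ha hm
      by_cases hi : i = P.goal
      · have hℓ : ℓ = P.goal := by
          rw [hi] at ht
          have hsupp := (P.trans P.goal a).apply_eq_one_iff P.goal |>.1 (habs a)
          have hmem : ℓ ∈ (P.trans P.goal a).support := ht.ne'
          simpa [hsupp] using hmem
        exact iSup_hitProb_of_mem κ G hℓ
      · exact iSup_hitProb_eq_one_of_mem_support κ G hi hC
          ((P.mem_support_memStep_iff ..).2 ⟨a, ha, ht, hm⟩)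
    · intro i m
      by_cases hi : i = P.goal <;> simp [hitProb, hG, hi]
    · intro i m hC
      have hpos : 0 < ⨆ n, hitProb κ G n (i, e m) := hC ▸ one_pos
      obtain ⟨n, hn⟩ := lt_iSup_iff.1 hpos
      refine hitProb_pos_of_card_le κ G ?_ hn
      rw [Nat.card_prod, hM', Nat.card_eq_fintype_card]
      exact hk
    · intro i m j hj _
      obtain ⟨j, rfl⟩ := Nat.exists_eq_add_of_le' hj
      simp only [Nat.add_sub_cancel]
      by_cases hi : i = P.goal
      · subst hi
        refine iff_of_true (hgoal _ _) ?_
        obtain ⟨a, ha⟩ := hexA (e m)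
        obtain ⟨m', hm'⟩ := hexM (e m) (P.obs P.goal) a
        exact ⟨a, ha, e.symm m', by simpa using hm', P.goal, by simp [habs], hgoal _ _⟩
      · rw [hitProb_succ_pos_iff κ G (t := (i, e m)) hi]
        constructor
        · rintro ⟨⟨i', m'⟩, hsupp, hpos⟩
          obtain ⟨a, ha, ht, hm⟩ := (P.mem_support_memStep_iff ..).1 hsupp
          exact ⟨a, ha, e.symm m', by simpa using hm, i', ht, by simpa using hpos⟩
        · rintro ⟨a, ha, m', hm, i', ht, hpos⟩
          exact ⟨(i', e m'), (P.mem_support_memStep_iff ..).2 ⟨a, ha, ht, hm⟩, hpos⟩
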